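/- Let λ ∈ [0,1] and let r be a nonnegative integer. Then for every x ∈ [0,1], max( (1 − x)^{r+1}, |x − λ| ) ≥ (1 − λ)^{r+1} / ( 1 + (r+1)·(1 − λ)^r ). -/

import Mathlib

open scoped BigOperators
open Matrix

noncomputable section

/-- The graph of `b ↦ b ^ (r + 1)` on the nonnegative reals lies above its tangent lines. -/
theorem tangent_line_le_pow_succ {a b : ℝ} (ha : 0 ≤ a) (hb : 0 ≤ b) (r : ℕ) :
    a ^ (r + 1) + (r + 1 : ℝ) * a ^ r * (b - a) ≤ b ^ (r + 1) := by
  induction r with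
  | zero => simp
  | succ k ih =>
    have hmul := mul_le_mul_of_nonneg_left ih hb
    have hsq : 0 ≤ a ^ k * ((k + 1 : ℝ) * (b - a) ^ 2) := by positivity
    push_cast
    calc a ^ (k + 1 + 1) + ((k : ℝ) + 1 + 1) * a ^ (k + 1) * (b - a)
        = b * (a ^ (k + 1) + (k + 1 : ℝ) * a ^ k * (b - a))
            - a ^ k * ((k + 1 : ℝ) * (b - a) ^ 2) := by ring
      _ ≤ b * b ^ (k + 1) := by linarith
      _ = b ^ (k + 1 + 1) := by ring

/-- lower bound for a max of two functions on `[0,1]`. -/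
theorem max_lower_bound_newton
    (lam : ℝ) (h0 : 0 ≤ lam) (h1 : lam ≤ 1) (r : ℕ)
    (x : ℝ) (hx0 : 0 ≤ x) (hx1 : x ≤ 1) :
    (1 - lam) ^ (r + 1) / (1 + (r + 1 : ℝ) * (1 - lam) ^ r)
      ≤ max ((1 - x) ^ (r + 1)) |x - lam| := by
  have htangent := tangent_line_le_pow_succ (sub_nonneg.2 h1) (sub_nonneg.2 hx1) r
  have hslope : 0 ≤ (r + 1 : ℝ) * (1 - lam) ^ r :=
    mul_nonneg (by positivity) (pow_nonneg (sub_nonneg.2 h1) r)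
  have hpow := le_max_left ((1 - x) ^ (r + 1)) |x - lam|
  have habs := le_max_right ((1 - x) ^ (r + 1)) |x - lam|
  have hmul := mul_le_mul_of_nonneg_left ((le_abs_self (x - lam)).trans habs) hslope
  rw [div_le_iff₀ (by linarith)]
  linarith
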